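/- arXiv:1609.08793 — 8 statements merged into one kernel-verified Lean document; each statement's English description precedes it below -/
import Mathlib

section
/- With the lattice N=4 SUSY field-space operators defined in the context, the following anticommutators vanish as linear endomorphisms of W: Q̄₊ ∘ Q̄₊ = 0, Q̄₋ ∘ Q̄₋ = 0, Q̄₊ ∘ Q̄₋ + Q̄₋ ∘ Q̄₊ = 0, Q₊ ∘ Q̄₋ + Q̄₋ ∘ Q₊ = 0, and Q₋ ∘ Q̄₊ + Q̄₊ ∘ Q₋ = 0. -/
open Complex

/-- Lattice fields: complex functions on the lattice `Λ`. -/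
abbrev LatField (Λ : Type*) := Λ → ℂ

/-- The full field space `W`, with components `(φ₊, φ₋, χ̄₊, χ̄₋, χ₊, χ₋, F₊, F₋)`. -/
abbrev FieldSpace (Λ : Type*) :=
  LatField Λ × LatField Λ × LatField Λ × LatField Λ ×
  LatField Λ × LatField Λ × LatField Λ × LatField Λ

/-- The supercharge `Q₊`:
`Q₊ (φ₊, φ₋, χ̄₊, χ̄₋, χ₊, χ₋, F₊, F₋) = (χ̄₊, 0, 0, 0, F₊, −i•∇φ₋, 0, −i•∇χ̄₋)`. -/
noncomputable def Qplus {Λ : Type*} (nab : LatField Λ →ₗ[ℂ] LatField Λ) :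
    FieldSpace Λ →ₗ[ℂ] FieldSpace Λ where
  toFun w :=
    (w.2.2.1, 0, 0, 0, w.2.2.2.2.2.2.1, (-I) • nab w.2.1, 0, (-I) • nab w.2.2.2.1)
  map_add' x y := by
    simp only [Prod.fst_add, Prod.snd_add, Prod.mk_add_mk, Prod.mk.injEq]
    and_intros <;> first | trivial | module | (rw [map_add]; module)
  map_smul' c x := by
    simp only [Prod.smul_fst, Prod.smul_snd, Prod.smul_mk, Prod.mk.injEq, RingHom.id_apply]
    and_intros <;> first | trivial | module | (rw [map_smul]; module)

/-- The supercharge `Q₋`: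
`Q₋ (φ₊, φ₋, χ̄₊, χ̄₋, χ₊, χ₋, F₊, F₋) = (0, −χ̄₋, 0, 0, i•∇φ₊, F₋, −i•∇χ̄₊, 0)`. -/
noncomputable def Qminus {Λ : Type*} (nab : LatField Λ →ₗ[ℂ] LatField Λ) :
    FieldSpace Λ →ₗ[ℂ] FieldSpace Λ where
  toFun w :=
    (0, -w.2.2.2.1, 0, 0, I • nab w.1, w.2.2.2.2.2.2.2, (-I) • nab w.2.2.1, 0)
  map_add' x y := by
    simp only [Prod.fst_add, Prod.snd_add, Prod.mk_add_mk, Prod.mk.injEq]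
    and_intros <;> first | trivial | module | (rw [map_add]; module)
  map_smul' c x := by
    simp only [Prod.smul_fst, Prod.smul_snd, Prod.smul_mk, Prod.mk.injEq, RingHom.id_apply]
    and_intros <;> first | trivial | module | (rw [map_smul]; module)

/-- The supercharge `Q̄₊`:
`Q̄₊ (φ₊, φ₋, χ̄₊, χ̄₋, χ₊, χ₋, F₊, F₋) = (0, χ₋, −i•∇φ₊, F₋, 0, 0, −i•∇χ₊, 0)`. -/
noncomputable def Qbarplus {Λ : Type*} (nab : LatField Λ →ₗ[ℂ] LatField Λ) :
    FieldSpace Λ →ₗ[ℂ] FieldSpace Λ where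
  toFun w :=
    (0, w.2.2.2.2.2.1, (-I) • nab w.1, w.2.2.2.2.2.2.2, 0, 0, (-I) • nab w.2.2.2.2.1, 0)
  map_add' x y := by
    simp only [Prod.fst_add, Prod.snd_add, Prod.mk_add_mk, Prod.mk.injEq]
    and_intros <;> first | trivial | module | (rw [map_add]; module)
  map_smul' c x := by
    simp only [Prod.smul_fst, Prod.smul_snd, Prod.smul_mk, Prod.mk.injEq, RingHom.id_apply]
    and_intros <;> first | trivial | module | (rw [map_smul]; module)

/-- The supercharge `Q̄₋`:
`Q̄₋ (φ₊, φ₋, χ̄₊, χ̄₋, χ₊, χ₋, F₊, F₋) = (−χ₊, 0, F₊, i•∇φ₋, 0, 0, 0, −i•∇χ₋)`. -/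
noncomputable def Qbarminus {Λ : Type*} (nab : LatField Λ →ₗ[ℂ] LatField Λ) :
    FieldSpace Λ →ₗ[ℂ] FieldSpace Λ where
  toFun w :=
    (-w.2.2.2.2.1, 0, w.2.2.2.2.2.2.1, I • nab w.2.1, 0, 0, 0, (-I) • nab w.2.2.2.2.2.1)
  map_add' x y := by
    simp only [Prod.fst_add, Prod.snd_add, Prod.mk_add_mk, Prod.mk.injEq]
    and_intros <;> first | trivial | module | (rw [map_add]; module)
  map_smul' c x := by
    simp only [Prod.smul_fst, Prod.smul_snd, Prod.smul_mk, Prod.mk.injEq, RingHom.id_apply]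
    and_intros <;> first | trivial | module | (rw [map_smul]; module)

/-- The vanishing anticommutators `{Q̄₊,Q̄₊} = {Q̄₋,Q̄₋} = {Q̄₊,Q̄₋} = {Q₊,Q̄₋} = {Q₋,Q̄₊} = 0`
as linear endomorphisms of the field space `W`. -/
theorem nilpotent_anticommutators {Λ : Type*} (nab : LatField Λ →ₗ[ℂ] LatField Λ) :
    Qbarplus nab ∘ₗ Qbarplus nab = 0 ∧
    Qbarminus nab ∘ₗ Qbarminus nab = 0 ∧
    Qbarplus nab ∘ₗ Qbarminus nab + Qbarminus nab ∘ₗ Qbarplus nab = 0 ∧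
    Qplus nab ∘ₗ Qbarminus nab + Qbarminus nab ∘ₗ Qplus nab = 0 ∧
    Qminus nab ∘ₗ Qbarplus nab + Qbarplus nab ∘ₗ Qminus nab = 0 := by
  refine ⟨?_, ?_, ?_, ?_, ?_⟩ <;>
  · refine LinearMap.ext fun w => ?_
    obtain ⟨a, b, c, d, e, f, g, h⟩ := w
    simp [Qplus, Qminus, Qbarplus, Qbarminus, smul_smul]
end

section
/- With the lattice N=4 SUSY field-space operators defined in the context, the U(1)_R charge operator R and the number operators N₊, N₋ satisfy: R ∘ Q₊ − Q₊ ∘ R = Q₊, R ∘ Q₋ − Q₋ ∘ R = −Q₋, R ∘ K₊ − K₊ ∘ R = −K₊, R ∘ K₋ − K₋ ∘ R = K₋; moreover N₊ and N₋ commute with each other and with Q₊, Q₋, K₊, K₋ and R. -/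
open Complex

/-- The homotopy operator `K₊`:
`K₊ (φ₊, φ₋, χ̄₊, χ̄₋, χ₊, χ₋, F₊, F₋) = (0, 0, φ₊, 0, 0, 0, χ₊, 0)`. -/
def Kplus {Λ : Type*} : FieldSpace Λ →ₗ[ℂ] FieldSpace Λ where
  toFun w := (0, 0, w.1, 0, 0, 0, w.2.2.2.2.1, 0)
  map_add' x y := by
    simp only [Prod.fst_add, Prod.snd_add, Prod.mk_add_mk, Prod.mk.injEq]
    and_intros <;> first | trivial | module
  map_smul' c x := by
    simp only [Prod.smul_fst, Prod.smul_snd, Prod.smul_mk, Prod.mk.injEq, RingHom.id_apply]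
    and_intros <;> first | trivial | module

/-- The homotopy operator `K₋`:
`K₋ (φ₊, φ₋, χ̄₊, χ̄₋, χ₊, χ₋, F₊, F₋) = (0, 0, 0, −φ₋, 0, 0, 0, χ₋)`. -/
def Kminus {Λ : Type*} : FieldSpace Λ →ₗ[ℂ] FieldSpace Λ where
  toFun w := (0, 0, 0, -w.2.1, 0, 0, 0, w.2.2.2.2.2.1)
  map_add' x y := by
    simp only [Prod.fst_add, Prod.snd_add, Prod.mk_add_mk, Prod.mk.injEq]
    and_intros <;> first | trivial | module
  map_smul' c x := by
    simp only [Prod.smul_fst, Prod.smul_snd, Prod.smul_mk, Prod.mk.injEq, RingHom.id_apply]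
    and_intros <;> first | trivial | module

/-- The number operator `N₊`: the projection of `W` onto its four `+`-components. -/
def Nplus {Λ : Type*} : FieldSpace Λ →ₗ[ℂ] FieldSpace Λ where
  toFun w := (w.1, 0, w.2.2.1, 0, w.2.2.2.2.1, 0, w.2.2.2.2.2.2.1, 0)
  map_add' x y := by
    simp only [Prod.fst_add, Prod.snd_add, Prod.mk_add_mk, Prod.mk.injEq]
    and_intros <;> first | trivial | module
  map_smul' c x := by
    simp only [Prod.smul_fst, Prod.smul_snd, Prod.smul_mk, Prod.mk.injEq, RingHom.id_apply]
    and_intros <;> first | trivial | module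

/-- The number operator `N₋`: the projection of `W` onto its four `−`-components. -/
def Nminus {Λ : Type*} : FieldSpace Λ →ₗ[ℂ] FieldSpace Λ where
  toFun w := (0, w.2.1, 0, w.2.2.2.1, 0, w.2.2.2.2.2.1, 0, w.2.2.2.2.2.2.2)
  map_add' x y := by
    simp only [Prod.fst_add, Prod.snd_add, Prod.mk_add_mk, Prod.mk.injEq]
    and_intros <;> first | trivial | module
  map_smul' c x := by
    simp only [Prod.smul_fst, Prod.smul_snd, Prod.smul_mk, Prod.mk.injEq, RingHom.id_apply]
    and_intros <;> first | trivial | module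

/-- The `U(1)_R` charge operator `R`:
`R (φ₊, φ₋, χ̄₊, χ̄₋, χ₊, χ₋, F₊, F₋) = (φ₊, −φ₋, 0, 0, 0, 0, −F₊, F₋)`. -/
def Rop {Λ : Type*} : FieldSpace Λ →ₗ[ℂ] FieldSpace Λ where
  toFun w := (w.1, -w.2.1, 0, 0, 0, 0, -w.2.2.2.2.2.2.1, w.2.2.2.2.2.2.2)
  map_add' x y := by
    simp only [Prod.fst_add, Prod.snd_add, Prod.mk_add_mk, Prod.mk.injEq]
    and_intros <;> first | trivial | module
  map_smul' c x := by
    simp only [Prod.smul_fst, Prod.smul_snd, Prod.smul_mk, Prod.mk.injEq, RingHom.id_apply]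
    and_intros <;> first | trivial | module

/-- The `U(1)_R` commutation relations with `Q₊, Q₋, K₊, K₋`, and the fact that the
number operators `N₊, N₋` commute with each other and with `Q₊, Q₋, K₊, K₋, R`. -/
theorem R_and_number_operator_relations {Λ : Type*}
    (nab : LatField Λ →ₗ[ℂ] LatField Λ) :
    Rop ∘ₗ Qplus nab - Qplus nab ∘ₗ Rop = Qplus nab ∧
    Rop ∘ₗ Qminus nab - Qminus nab ∘ₗ Rop = -Qminus nab ∧
    (Rop : FieldSpace Λ →ₗ[ℂ] FieldSpace Λ) ∘ₗ Kplus - Kplus ∘ₗ Rop = -Kplus ∧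
    (Rop : FieldSpace Λ →ₗ[ℂ] FieldSpace Λ) ∘ₗ Kminus - Kminus ∘ₗ Rop = Kminus ∧
    (Nplus : FieldSpace Λ →ₗ[ℂ] FieldSpace Λ) ∘ₗ Nminus = Nminus ∘ₗ Nplus ∧
    Nplus ∘ₗ Qplus nab = Qplus nab ∘ₗ Nplus ∧
    Nplus ∘ₗ Qminus nab = Qminus nab ∘ₗ Nplus ∧
    (Nplus : FieldSpace Λ →ₗ[ℂ] FieldSpace Λ) ∘ₗ Kplus = Kplus ∘ₗ Nplus ∧
    (Nplus : FieldSpace Λ →ₗ[ℂ] FieldSpace Λ) ∘ₗ Kminus = Kminus ∘ₗ Nplus ∧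
    (Nplus : FieldSpace Λ →ₗ[ℂ] FieldSpace Λ) ∘ₗ Rop = Rop ∘ₗ Nplus ∧
    Nminus ∘ₗ Qplus nab = Qplus nab ∘ₗ Nminus ∧
    Nminus ∘ₗ Qminus nab = Qminus nab ∘ₗ Nminus ∧
    (Nminus : FieldSpace Λ →ₗ[ℂ] FieldSpace Λ) ∘ₗ Kplus = Kplus ∘ₗ Nminus ∧
    (Nminus : FieldSpace Λ →ₗ[ℂ] FieldSpace Λ) ∘ₗ Kminus = Kminus ∘ₗ Nminus ∧
    (Nminus : FieldSpace Λ →ₗ[ℂ] FieldSpace Λ) ∘ₗ Rop = Rop ∘ₗ Nminus := by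
  refine ⟨?_, ?_, ?_, ?_, ?_, ?_, ?_, ?_, ?_, ?_, ?_, ?_, ?_, ?_, ?_⟩ <;>
  · refine LinearMap.ext fun w => ?_
    obtain ⟨a, b, c, d, e, f, g, h⟩ := w
    simp [Qplus, Qminus, Kplus, Kminus, Nplus, Nminus, Rop]
end

section
/- Invariance of the three-point interaction is equivalent to the cyclic Leibniz rule: let Λ be a finite type, ∇ : Λ → Λ → ℝ and M : Λ → Λ → Λ → ℝ with M symmetric in its last two arguments. Then the functional identity ⟨∇A, B*C⟩ + ⟨∇B, C*A⟩ + ⟨∇C, A*B⟩ = 0 holds for all fields A, B, C : Λ → ℝ if and only if the coefficient identity ∑_k (∇ k ℓ * M k m n + ∇ k m * M k n ℓ + ∇ k n * M k ℓ m) = 0 holds for all ℓ, m, n ∈ Λ. -/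
open Finset

lemma threePoint_expand {Λ : Type*} [Fintype Λ]
    (nab : Λ → Λ → ℝ) (M : Λ → Λ → Λ → ℝ) (A B C : Λ → ℝ) :
    (∑ ℓ, (∑ j, nab ℓ j * A j) * (∑ m, ∑ n, M ℓ m n * B m * C n))
      = ∑ a, ∑ b, ∑ c, (∑ k, nab k a * M k b c) * (A a * B b * C c) := by
  simp only [Finset.sum_mul]
  simp only [Finset.mul_sum]
  rw [Finset.sum_comm]
  refine Finset.sum_congr rfl fun a _ => ?_
  rw [Finset.sum_comm]
  refine Finset.sum_congr rfl fun b _ => ?_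
  rw [Finset.sum_comm]
  refine Finset.sum_congr rfl fun c _ => ?_
  refine Finset.sum_congr rfl fun k _ => ?_
  ring

lemma sum_rotate {Λ : Type*} [Fintype Λ] (f : Λ → Λ → Λ → ℝ) :
    ∑ b, ∑ c, ∑ a, f a b c = ∑ a, ∑ b, ∑ c, f a b c := by
  rw [Finset.sum_comm (f := fun a b => ∑ c, f a b c)]
  exact Finset.sum_congr rfl fun b _ => Finset.sum_comm

/-- Invariance of the three-point interaction is equivalent to the cyclic Leibniz rule:
with `⟨f, g⟩ = ∑ n, f n * g n`, `(∇A) m = ∑ n, ∇ m n * A n` and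
`(A*B) ℓ = ∑ m n, M ℓ m n * A m * B n`, the identity
`⟨∇A, B*C⟩ + ⟨∇B, C*A⟩ + ⟨∇C, A*B⟩ = 0` for all fields `A, B, C` holds if and only if
`∑ k, (∇ k ℓ * M k m n + ∇ k m * M k n ℓ + ∇ k n * M k ℓ m) = 0` for all sites `ℓ, m, n`. -/
theorem threePoint_invariance_iff_CLR {Λ : Type*} [Fintype Λ]
    (nab : Λ → Λ → ℝ) (M : Λ → Λ → Λ → ℝ)
    (hM : ∀ ℓ m n, M ℓ m n = M ℓ n m) :
    (∀ A B C : Λ → ℝ,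
        (∑ ℓ, (∑ j, nab ℓ j * A j) * (∑ m, ∑ n, M ℓ m n * B m * C n))
      + (∑ ℓ, (∑ j, nab ℓ j * B j) * (∑ m, ∑ n, M ℓ m n * C m * A n))
      + (∑ ℓ, (∑ j, nab ℓ j * C j) * (∑ m, ∑ n, M ℓ m n * A m * B n)) = 0)
    ↔ (∀ ℓ m n, ∑ k, (nab k ℓ * M k m n + nab k m * M k n ℓ + nab k n * M k ℓ m) = 0) := by
  have key : ∀ A B C : Λ → ℝ,
        (∑ ℓ, (∑ j, nab ℓ j * A j) * (∑ m, ∑ n, M ℓ m n * B m * C n))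
      + (∑ ℓ, (∑ j, nab ℓ j * B j) * (∑ m, ∑ n, M ℓ m n * C m * A n))
      + (∑ ℓ, (∑ j, nab ℓ j * C j) * (∑ m, ∑ n, M ℓ m n * A m * B n))
      = ∑ a, ∑ b, ∑ c,
        (∑ k, (nab k a * M k b c + nab k b * M k c a + nab k c * M k a b))
          * (A a * B b * C c) := by
    intro A B C
    rw [threePoint_expand nab M A B C, threePoint_expand nab M B C A,
      threePoint_expand nab M C A B,
      sum_rotate (fun a b c => (∑ k, nab k b * M k c a) * (B b * C c * A a)),
      ← sum_rotate (fun c a b => (∑ k, nab k c * M k a b) * (C c * A a * B b))]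
    simp only [← Finset.sum_add_distrib]
    refine Finset.sum_congr rfl fun a _ => Finset.sum_congr rfl fun b _ =>
      Finset.sum_congr rfl fun c _ => ?_
    simp only [Finset.sum_add_distrib]
    ring
  simp only [key]
  constructor
  · intro h a b c
    classical
    have := h (Pi.single a 1) (Pi.single b 1) (Pi.single c 1)
    simpa [Pi.single_apply] using this
  · intro h A B C
    simp only [h, zero_mul, Finset.sum_const_zero]
end

section
/- Invariance of the (k+1)-point interaction is equivalent to the k-th cyclic Leibniz rule: let Λ be a finite type, k ≥ 1, ∇ : Λ → Λ → ℝ, and M : Λ → (Fin k → Λ) → ℝ invariant under all permutations of its Fin k arguments. Then the functional identity ∑_{c=0}^{k} ⟨∇B^{(c)}, [[B^{(c+1)}, …, B^{(c+k)}]]⟩ = 0 (indices mod k+1, cyclic sum) holds for all fields B^{(0)}, …, B^{(k)} : Λ → ℝ if and only if for all n : Fin (k+1) → Λ one has ∑_{c=0}^{k} ∑_m ∇ m (n c) * M m (n ∘ (shift by c on the remaining k cyclic positions)) = 0, i.e. the cyclic sum over cyclic permutations p of {0,1,…,k} of ∑_m ∇ m (n (p 0)) * M m (n (p 1), …, n (p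 k)) vanishes. -/
open Finset

theorem clr_aux {Λ : Type*} [Fintype Λ] (k : ℕ)
    (f : Λ → ℝ) (M : (Fin k → Λ) → ℝ) (B : Fin (k + 1) → Λ → ℝ) (c : Fin (k + 1)) :
    (∑ j : Λ, f j * B c j) * (∑ n : Fin k → Λ, M n * ∏ i : Fin k, B (c + i.succ) (n i))
    = ∑ n : Fin (k + 1) → Λ,
        f (n c) * M (fun i : Fin k => n (c + i.succ)) * ∏ i, B i (n i) := by
  have h1 : ∀ n : Fin (k + 1) → Λ, ∏ i, B i (n i)
      = B c (n c) * ∏ i : Fin k, B (c + i.succ) (n (c + i.succ)) := by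
    intro n
    rw [← Equiv.prod_comp (Equiv.addLeft c) (fun i => B i (n i)), Fin.prod_univ_succ]
    simp
  simp_rw [h1]
  let g : (Fin (k + 1) → Λ) → ℝ := fun n => f (n 0) * M (fun i => n i.succ) *
    (B c (n 0) * ∏ i : Fin k, B (c + i.succ) (n i.succ))
  have h2 : (∑ n : Fin (k + 1) → Λ, f (n c) * M (fun i : Fin k => n (c + i.succ)) *
      (B c (n c) * ∏ i : Fin k, B (c + i.succ) (n (c + i.succ)))) = ∑ n, g n := by
    rw [← Equiv.sum_comp (Equiv.arrowCongr (Equiv.addLeft c).symm (Equiv.refl Λ)) g]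
    apply Finset.sum_congr rfl
    intro n _
    simp [g, Equiv.arrowCongr]
  rw [h2, ← Equiv.sum_comp (Fin.consEquiv (fun _ => Λ)) g, Fintype.sum_prod_type,
    Finset.sum_mul_sum]
  refine Finset.sum_congr rfl fun j _ => Finset.sum_congr rfl fun n _ => ?_
  simp only [g, Fin.consEquiv_apply, Fin.cons_zero, Fin.cons_succ]
  ring

/-- Invariance of the `(k+1)`-point interaction is equivalent to the `k`-th cyclic
Leibniz rule: with the multi-field product
`[[B¹,…,Bᵏ]] m = ∑ (n : Fin k → Λ), M m n * ∏ i, Bⁱ (n i)`,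
the inner product `⟨f, g⟩ = ∑ n, f n * g n` and `(∇A) m = ∑ j, ∇ m j * A j`,
the cyclic functional identity
`∑ c, ⟨∇B⁽ᶜ⁾, [[B⁽ᶜ⁺¹⁾,…,B⁽ᶜ⁺ᵏ⁾]]⟩ = 0` (indices mod `k+1`) for all fields
`B⁽⁰⁾,…,B⁽ᵏ⁾ : Λ → ℝ` holds if and only if for all `n : Fin (k+1) → Λ` the cyclic sum
`∑ c, ∑ m, ∇ m (n c) * M m (fun i => n (c + i.succ)) = 0` holds. -/
theorem multiPoint_invariance_iff_CLR {Λ : Type*} [Fintype Λ] (k : ℕ) (hk : 1 ≤ k)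
    (nab : Λ → Λ → ℝ) (M : Λ → (Fin k → Λ) → ℝ)
    (hM : ∀ (m : Λ) (σ : Equiv.Perm (Fin k)) (n : Fin k → Λ), M m (n ∘ σ) = M m n) :
    (∀ B : Fin (k + 1) → Λ → ℝ,
        ∑ c : Fin (k + 1), ∑ m : Λ,
          (∑ j : Λ, nab m j * B c j) *
            (∑ n : Fin k → Λ, M m n * ∏ i : Fin k, B (c + i.succ) (n i)) = 0)
    ↔ (∀ n : Fin (k + 1) → Λ,
        ∑ c : Fin (k + 1), ∑ m : Λ,
          nab m (n c) * M m (fun i : Fin k => n (c + i.succ)) = 0) := by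
  classical
  have key : ∀ B : Fin (k + 1) → Λ → ℝ,
      (∑ c : Fin (k + 1), ∑ m : Λ, (∑ j : Λ, nab m j * B c j) *
        (∑ n : Fin k → Λ, M m n * ∏ i : Fin k, B (c + i.succ) (n i)))
      = ∑ n : Fin (k + 1) → Λ, (∑ c : Fin (k + 1), ∑ m : Λ,
          nab m (n c) * M m (fun i : Fin k => n (c + i.succ))) * ∏ i, B i (n i) := by
    intro B
    simp_rw [clr_aux, Finset.sum_mul]
    conv_rhs => rw [Finset.sum_comm]
    refine Finset.sum_congr rfl fun c _ => ?_
    rw [Finset.sum_comm]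
  constructor
  · intro h n₀
    have h0 := h (fun i x => if x = n₀ i then 1 else 0)
    rw [key] at h0
    rw [Finset.sum_eq_single n₀] at h0
    · simpa using h0
    · intro n _ hn
      obtain ⟨i, hi⟩ := Function.ne_iff.mp hn
      rw [Finset.prod_eq_zero (Finset.mem_univ i) (by simp [hi]), mul_zero]
    · simp
  · intro h B
    rw [key]
    simp [h]
end

section
/- The explicit pair (∇, M) on the integer lattice satisfies the cyclic Leibniz rule: define ∇ : ℤ → ℤ → ℚ by ∇ m n := (1/2)·([m = n − 1] − [m = n + 1]) and M : ℤ → ℤ → ℤ → ℚ by M ℓ m n := (1/6)·(2·[ℓ = m − 1]·[ℓ = n − 1] + [ℓ = n − 1]·[ℓ = m + 1] + [ℓ = n + 1]·[ℓ = m − 1] + 2·[ℓ = m + 1]·[ℓ = n + 1]), where [P] denotes 1 if P holds and 0 otherwise. Then M ℓ m n = M ℓ n m for all ℓ, m, n, and for all ℓ, m, n ∈ ℤ the (finitely supported) sum over k ∈ ℤ of (∇ k ℓ * M k m n + ∇ k m * M k n ℓ + ∇ k n * M k ℓ m) equals 0. -/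
/-- The symmetric difference operator `∇ m n = ([m = n − 1] − [m = n + 1])/2`
on the integer lattice. -/
def nablaZ (m n : ℤ) : ℚ :=
  (1 / 2) * ((if m = n - 1 then (1 : ℚ) else 0) - (if m = n + 1 then (1 : ℚ) else 0))

/-- The product coefficient
`M ℓ m n = (2·[ℓ = m−1]·[ℓ = n−1] + [ℓ = n−1]·[ℓ = m+1] + [ℓ = n+1]·[ℓ = m−1]
  + 2·[ℓ = m+1]·[ℓ = n+1])/6` on the integer lattice. -/
def MZ (ℓ m n : ℤ) : ℚ :=
  (1 / 6) * (2 * (if ℓ = m - 1 then (1 : ℚ) else 0) * (if ℓ = n - 1 then (1 : ℚ) else 0)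
    + (if ℓ = n - 1 then (1 : ℚ) else 0) * (if ℓ = m + 1 then (1 : ℚ) else 0)
    + (if ℓ = n + 1 then (1 : ℚ) else 0) * (if ℓ = m - 1 then (1 : ℚ) else 0)
    + 2 * (if ℓ = m + 1 then (1 : ℚ) else 0) * (if ℓ = n + 1 then (1 : ℚ) else 0))

/-- The explicit pair `(∇, M)` on the integer lattice is symmetric in the last two
arguments of `M` and satisfies the cyclic Leibniz rule. -/
theorem explicit_pair_satisfies_CLR :
    (∀ ℓ m n : ℤ, MZ ℓ m n = MZ ℓ n m) ∧
    (∀ ℓ m n : ℤ,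
      (∑ᶠ k : ℤ, (nablaZ k ℓ * MZ k m n + nablaZ k m * MZ k n ℓ + nablaZ k n * MZ k ℓ m))
        = 0) := by
  refine ⟨fun ℓ m n => by unfold MZ; ring, fun ℓ m n => ?_⟩
  have key : ∀ k : ℤ,
      nablaZ k ℓ * MZ k m n + nablaZ k m * MZ k n ℓ + nablaZ k n * MZ k ℓ m
        = (if k = ℓ - 1 then (if ℓ = m ∧ ℓ = n then (1 / 2 : ℚ) else 0) else 0)
          - (if k = ℓ + 1 then (if ℓ = m ∧ ℓ = n then (1 / 2 : ℚ) else 0) else 0) := by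
    intro k
    have h1 : (if k = ℓ - 1 then (if ℓ = m ∧ ℓ = n then (1 / 2 : ℚ) else 0) else 0)
        = 1 / 2 * (if k = ℓ - 1 then (1 : ℚ) else 0) * (if k = m - 1 then (1 : ℚ) else 0)
          * (if k = n - 1 then (1 : ℚ) else 0) := by
      split_ifs <;> first | omega | norm_num
    have h2 : (if k = ℓ + 1 then (if ℓ = m ∧ ℓ = n then (1 / 2 : ℚ) else 0) else 0)
        = 1 / 2 * (if k = ℓ + 1 then (1 : ℚ) else 0) * (if k = m + 1 then (1 : ℚ) else 0)
          * (if k = n + 1 then (1 : ℚ) else 0) := by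
      split_ifs <;> first | omega | norm_num
    rw [h1, h2]
    unfold nablaZ MZ
    ring
  rw [finsum_congr key, finsum_eq_sum_of_support_subset (s := {ℓ - 1, ℓ + 1})]
  · rw [Finset.sum_sub_distrib, Finset.sum_ite_eq', Finset.sum_ite_eq']
    simp
  · intro k hk
    by_contra h
    simp only [Finset.coe_insert, Finset.coe_singleton, Set.mem_insert_iff,
      Set.mem_singleton_iff, not_or] at h
    apply hk
    simp [h.1, h.2]
end

section
/- CLR contraction with a symmetric tensor: let Λ be a finite type, ∇ : Λ → Λ → ℝ, M : Λ → Λ → Λ → ℝ symmetric in its last two arguments and satisfying the cyclic Leibniz rule with ∇, and let X : Λ → Λ → ℝ be symmetric (X k ℓ = X ℓ k). Then for every n ∈ Λ: ∑_{k,ℓ} (∇ᵀM) n k ℓ * X k ℓ = −2 · ∑_{k,ℓ} (∇ᵀM) k n ℓ * X k ℓ, where (∇ᵀM) a b c := ∑_k ∇ k a * M k b c. -/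
open Finset

/-- CLR contraction with a symmetric tensor: if `(∇, M)` satisfies the cyclic Leibniz
rule, `M` is symmetric in its last two arguments and `X` is symmetric, then
`∑ k ℓ, (∇ᵀM) n k ℓ * X k ℓ = −2 · ∑ k ℓ, (∇ᵀM) k n ℓ * X k ℓ`,
where `(∇ᵀM) a b c = ∑ k, ∇ k a * M k b c`. -/
theorem CLR_symmetric_contraction {Λ : Type*} [Fintype Λ]
    (nab : Λ → Λ → ℝ) (M : Λ → Λ → Λ → ℝ)
    (hM : ∀ ℓ m n, M ℓ m n = M ℓ n m)
    (hCLR : ∀ ℓ m n, ∑ k, (nab k ℓ * M k m n + nab k m * M k n ℓ + nab k n * M k ℓ m) = 0)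
    (X : Λ → Λ → ℝ) (hX : ∀ k ℓ, X k ℓ = X ℓ k) :
    ∀ n, ∑ k, ∑ ℓ, (∑ a, nab a n * M a k ℓ) * X k ℓ
      = -2 * ∑ k, ∑ ℓ, (∑ a, nab a k * M a n ℓ) * X k ℓ := by
  intro n
  have key : ∀ k ℓ, (∑ a, nab a n * M a k ℓ) * X k ℓ
      = -((∑ a, nab a k * M a n ℓ) * X k ℓ) - (∑ a, nab a ℓ * M a n k) * X ℓ k := by
    intro k ℓ
    have h := hCLR n k ℓ
    rw [Finset.sum_add_distrib, Finset.sum_add_distrib] at h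
    have h2 : ∑ a, nab a k * M a ℓ n = ∑ a, nab a k * M a n ℓ :=
      Finset.sum_congr rfl fun a _ => by rw [hM a ℓ n]
    rw [h2] at h
    rw [hX ℓ k]
    linear_combination (X k ℓ) * h
  have swap : ∑ k, ∑ ℓ, (∑ a, nab a ℓ * M a n k) * X ℓ k
      = ∑ k, ∑ ℓ, (∑ a, nab a k * M a n ℓ) * X k ℓ := Finset.sum_comm
  simp only [key, Finset.sum_sub_distrib, Finset.sum_neg_distrib]
  rw [swap]
  ring
end

section
/- One-loop SUSY Ward identity relating the scalar and auxiliary-field self-energies: let Λ be a finite type, ∇ : Λ → Λ → ℝ antisymmetric (∇ m n = −∇ n m), D : Λ → Λ → ℝ symmetric (D m n = D n m), and M : Λ → Λ → Λ → ℝ symmetric in its last two arguments and satisfying the cyclic Leibniz rule with ∇. Define Σ_FF (n, m) := 2 ∑_{k,ℓ,i,j} M n k ℓ * M m i j * D i k * D j ℓ and Σ_φφ (n, m) := −4 ∑_{ℓ,k,i,j} M ℓ k n * M i j m * (∇D∇ᵀ) ℓ i * D k j − 4 ∑_{k,ℓ,i,j} M k ℓ n * M i j m * (∇D) k j * (D∇ᵀ)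 ℓ i, where (∇D) k j := ∑_a ∇ k a * D a j, (D∇ᵀ) ℓ i := ∑_b D ℓ b * ∇ i b, and (∇D∇ᵀ) ℓ i := ∑_{a,b} ∇ ℓ a * D a b * ∇ i b. Then for all n, m ∈ Λ: Σ_φφ (n, m) = −∑_{a,b} ∇ a n * Σ_FF (a, b) * ∇ b m. -/
open Finset

/-- Exchange of summations used for both scalar diagrams. -/
theorem ward_aux1 {Λ : Type*} [Fintype Λ] (nab : Λ → Λ → ℝ) (X Y : Λ → Λ → ℝ)
    (W : Λ → Λ → Λ → Λ → ℝ) :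
    ∑ ℓ, ∑ k, ∑ i, ∑ j, X ℓ k * Y i j * (∑ a, ∑ b, nab ℓ a * nab i b * W a b k j)
      = ∑ a, ∑ k, ∑ b, ∑ j,
          (∑ ℓ, nab ℓ a * X ℓ k) * (∑ i, nab i b * Y i j) * W a b k j := by
  simp only [Finset.sum_mul_sum]
  simp only [Finset.mul_sum, Finset.sum_mul]
  have e : ∀ f : Λ → Λ → Λ → Λ → Λ → Λ → ℝ,
      ∑ ℓ, ∑ k, ∑ i, ∑ j, ∑ a, ∑ b, f ℓ k i j a b
        = ∑ a, ∑ k, ∑ b, ∑ j, ∑ ℓ, ∑ i, f ℓ k i j a b := by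
    intro f
    have h1 : ∑ ℓ, ∑ k, ∑ i, ∑ j, ∑ a, ∑ b, f ℓ k i j a b
        = ∑ p : Λ × Λ × Λ × Λ × Λ × Λ,
            f p.1 p.2.1 p.2.2.1 p.2.2.2.1 p.2.2.2.2.1 p.2.2.2.2.2 := by
      simp only [Fintype.sum_prod_type]
    have h2 : ∑ a, ∑ k, ∑ b, ∑ j, ∑ ℓ, ∑ i, f ℓ k i j a b
        = ∑ p : Λ × Λ × Λ × Λ × Λ × Λ,
            f p.2.2.2.2.1 p.2.1 p.2.2.2.2.2 p.2.2.2.1 p.1 p.2.2.1 := by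
      simp only [Fintype.sum_prod_type]
    rw [h1, h2]
    refine Finset.sum_nbij'
      (fun p => (p.2.2.2.2.1, p.2.1, p.2.2.2.2.2, p.2.2.2.1, p.1, p.2.2.1))
      (fun p => (p.2.2.2.2.1, p.2.1, p.2.2.2.2.2, p.2.2.2.1, p.1, p.2.2.1))
      ?_ ?_ ?_ ?_ ?_ <;> simp
  rw [e]
  refine Finset.sum_congr rfl fun a _ => Finset.sum_congr rfl fun k _ =>
    Finset.sum_congr rfl fun b _ => Finset.sum_congr rfl fun j _ =>
    Finset.sum_congr rfl fun ℓ _ => Finset.sum_congr rfl fun i _ => ?_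
  ring

/-- Exchange of summations used for the auxiliary-field diagram. -/
theorem ward_aux2 {Λ : Type*} [Fintype Λ] (u v : Λ → ℝ) (M : Λ → Λ → Λ → ℝ)
    (D : Λ → Λ → ℝ) :
    ∑ a, ∑ b, u a * (2 * ∑ k, ∑ ℓ, ∑ i, ∑ j, M a k ℓ * M b i j * D i k * D j ℓ) * v b
      = 2 * ∑ k, ∑ ℓ, ∑ i, ∑ j,
          (∑ a, u a * M a k ℓ) * (∑ b, v b * M b i j) * D i k * D j ℓ := by
  simp only [Finset.sum_mul_sum]
  simp only [Finset.mul_sum, Finset.sum_mul]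
  have e : ∀ f : Λ → Λ → Λ → Λ → Λ → Λ → ℝ,
      ∑ a, ∑ b, ∑ k, ∑ ℓ, ∑ i, ∑ j, f a b k ℓ i j
        = ∑ k, ∑ ℓ, ∑ i, ∑ j, ∑ a, ∑ b, f a b k ℓ i j := by
    intro f
    have h1 : ∑ a, ∑ b, ∑ k, ∑ ℓ, ∑ i, ∑ j, f a b k ℓ i j
        = ∑ p : Λ × Λ × Λ × Λ × Λ × Λ,
            f p.1 p.2.1 p.2.2.1 p.2.2.2.1 p.2.2.2.2.1 p.2.2.2.2.2 := by
      simp only [Fintype.sum_prod_type]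
    have h2 : ∑ k, ∑ ℓ, ∑ i, ∑ j, ∑ a, ∑ b, f a b k ℓ i j
        = ∑ p : Λ × Λ × Λ × Λ × Λ × Λ,
            f p.2.2.2.2.1 p.2.2.2.2.2 p.1 p.2.1 p.2.2.1 p.2.2.2.1 := by
      simp only [Fintype.sum_prod_type]
    rw [h1, h2]
    refine Finset.sum_nbij'
      (fun p => (p.2.2.1, p.2.2.2.1, p.2.2.2.2.1, p.2.2.2.2.2, p.1, p.2.1))
      (fun p => (p.2.2.2.2.1, p.2.2.2.2.2, p.1, p.2.1, p.2.2.1, p.2.2.2.1))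
      ?_ ?_ ?_ ?_ ?_ <;> simp
  rw [e]
  refine Finset.sum_congr rfl fun a _ => Finset.sum_congr rfl fun k _ =>
    Finset.sum_congr rfl fun b _ => Finset.sum_congr rfl fun j _ =>
    Finset.sum_congr rfl fun ℓ _ => Finset.sum_congr rfl fun i _ => ?_
  ring

/-- One-loop SUSY Ward identity relating the scalar and auxiliary-field self-energies:
with `Σ_FF (n, m) = 2 ∑ M n k ℓ * M m i j * D i k * D j ℓ` and
`Σ_φφ (n, m) = −4 ∑ M ℓ k n * M i j m * (∇D∇ᵀ) ℓ i * D k j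
  − 4 ∑ M k ℓ n * M i j m * (∇D) k j * (D∇ᵀ) ℓ i`,
the cyclic Leibniz rule implies `Σ_φφ (n, m) = −∑ a b, ∇ a n * Σ_FF (a, b) * ∇ b m`. -/
theorem one_loop_ward_identity {Λ : Type*} [Fintype Λ]
    (nab D : Λ → Λ → ℝ) (M : Λ → Λ → Λ → ℝ)
    (hnab : ∀ m n, nab m n = -nab n m)
    (hD : ∀ m n, D m n = D n m)
    (hM : ∀ ℓ m n, M ℓ m n = M ℓ n m)
    (hCLR : ∀ ℓ m n, ∑ k, (nab k ℓ * M k m n + nab k m * M k n ℓ + nab k n * M k ℓ m) = 0) :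
    ∀ n m : Λ,
      (-4 * ∑ ℓ, ∑ k, ∑ i, ∑ j,
          M ℓ k n * M i j m * (∑ a, ∑ b, nab ℓ a * D a b * nab i b) * D k j)
      + (-4 * ∑ k, ∑ ℓ, ∑ i, ∑ j,
          M k ℓ n * M i j m * (∑ a, nab k a * D a j) * (∑ b, D ℓ b * nab i b))
      = -∑ a, ∑ b, nab a n *
          (2 * ∑ k, ∑ ℓ, ∑ i, ∑ j, M a k ℓ * M b i j * D i k * D j ℓ) * nab b m := by
  intro n m
  obtain ⟨P, hP⟩ : ∃ P : Λ → Λ → Λ → ℝ, ∀ n x y, P n x y = ∑ ℓ, nab ℓ x * M ℓ y n :=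
    ⟨_, fun _ _ _ => rfl⟩
  have hA : ∀ n k l, ∑ a, nab a n * M a k l = -(P n k l + P n l k) := by
    intro n k l
    have h := hCLR n k l
    simp only [Finset.sum_add_distrib] at h
    have h3 : ∑ x, nab x l * M x n k = P n l k := by
      rw [hP]
      exact Finset.sum_congr rfl fun x _ => by rw [hM x n k]
    rw [h3, ← hP n k l] at h
    linarith
  have h1 : ∑ ℓ, ∑ k, ∑ i, ∑ j,
        M ℓ k n * M i j m * (∑ a, ∑ b, nab ℓ a * D a b * nab i b) * D k j
      = ∑ a, ∑ k, ∑ b, ∑ j, P n a k * P m b j * (D a b * D k j) := by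
    simp only [hP]
    rw [← ward_aux1 nab (fun ℓ k => M ℓ k n) (fun i j => M i j m)
      (fun a b k j => D a b * D k j)]
    refine Finset.sum_congr rfl fun ℓ _ => Finset.sum_congr rfl fun k _ =>
      Finset.sum_congr rfl fun i _ => Finset.sum_congr rfl fun j _ => ?_
    rw [mul_assoc]
    congr 1
    simp only [Finset.sum_mul]
    refine Finset.sum_congr rfl fun a _ => Finset.sum_congr rfl fun b _ => ?_
    ring
  have h2 : ∑ k, ∑ ℓ, ∑ i, ∑ j,
        M k ℓ n * M i j m * (∑ a, nab k a * D a j) * (∑ b, D ℓ b * nab i b)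
      = ∑ a, ∑ k, ∑ b, ∑ j, P n a k * P m b j * (D a j * D k b) := by
    simp only [hP]
    rw [← ward_aux1 nab (fun ℓ k => M ℓ k n) (fun i j => M i j m)
      (fun a b k j => D a j * D k b)]
    refine Finset.sum_congr rfl fun ℓ _ => Finset.sum_congr rfl fun k _ =>
      Finset.sum_congr rfl fun i _ => Finset.sum_congr rfl fun j _ => ?_
    rw [mul_assoc]
    congr 1
    rw [Finset.sum_mul_sum]
    refine Finset.sum_congr rfl fun a _ => Finset.sum_congr rfl fun b _ => ?_
    ring
  have h3 : ∑ a, ∑ b, nab a n *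
          (2 * ∑ k, ∑ ℓ, ∑ i, ∑ j, M a k ℓ * M b i j * D i k * D j ℓ) * nab b m
      = 2 * ∑ k, ∑ ℓ, ∑ i, ∑ j,
          (P n k ℓ + P n ℓ k) * (P m i j + P m j i) * D i k * D j ℓ := by
    rw [ward_aux2 (fun a => nab a n) (fun b => nab b m) M D]
    simp only [hA, neg_mul_neg]
  -- the four pieces of the expanded product
  have q1 : ∑ k, ∑ ℓ, ∑ i, ∑ j, P n k ℓ * P m j i * (D k i * D ℓ j)
      = ∑ a, ∑ k, ∑ b, ∑ j, P n a k * P m b j * (D a j * D k b) := by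
    refine Finset.sum_congr rfl fun k _ => Finset.sum_congr rfl fun ℓ _ => ?_
    exact Finset.sum_comm
  have q2 : ∑ k, ∑ ℓ, ∑ i, ∑ j, P n ℓ k * P m i j * (D k i * D ℓ j)
      = ∑ a, ∑ k, ∑ b, ∑ j, P n a k * P m b j * (D a j * D k b) := by
    rw [Finset.sum_comm]
    refine Finset.sum_congr rfl fun k _ => Finset.sum_congr rfl fun ℓ _ =>
      Finset.sum_congr rfl fun i _ => Finset.sum_congr rfl fun j _ => ?_
    ring
  have q3 : ∑ k, ∑ ℓ, ∑ i, ∑ j, P n ℓ k * P m j i * (D k i * D ℓ j)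
      = ∑ a, ∑ k, ∑ b, ∑ j, P n a k * P m b j * (D a b * D k j) := by
    rw [Finset.sum_comm]
    refine Finset.sum_congr rfl fun k _ => Finset.sum_congr rfl fun ℓ _ => ?_
    rw [Finset.sum_comm]
    refine Finset.sum_congr rfl fun i _ => Finset.sum_congr rfl fun j _ => ?_
    ring
  have h4 : ∑ k, ∑ ℓ, ∑ i, ∑ j,
          (P n k ℓ + P n ℓ k) * (P m i j + P m j i) * D i k * D j ℓ
      = ∑ k, ∑ ℓ, ∑ i, ∑ j, P n k ℓ * P m i j * (D k i * D ℓ j)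
        + ∑ k, ∑ ℓ, ∑ i, ∑ j, P n k ℓ * P m j i * (D k i * D ℓ j)
        + ∑ k, ∑ ℓ, ∑ i, ∑ j, P n ℓ k * P m i j * (D k i * D ℓ j)
        + ∑ k, ∑ ℓ, ∑ i, ∑ j, P n ℓ k * P m j i * (D k i * D ℓ j) := by
    simp only [← Finset.sum_add_distrib]
    refine Finset.sum_congr rfl fun k _ => Finset.sum_congr rfl fun ℓ _ =>
      Finset.sum_congr rfl fun i _ => Finset.sum_congr rfl fun j _ => ?_
    rw [hD i k, hD j ℓ]
    ring
  rw [h1, h2, h3, h4, q1, q2, q3]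
  ring
end

section
/- Appendix B solution of the linear ∇̃-equation, case M = 2: let ε > 0, let g : ℂ → ℂ be holomorphic on the annulus A_ε and not identically zero on A_ε, let N ≥ 2, and let A₁, A₂ : (Fin N → ℂ) → ℂ be holomorphic on A_ε^N such that A₁ z * g (z 0) + A₂ z * g (z 1) = 0 for all z ∈ A_ε^N. Then there exists B : (Fin N → ℂ) → ℂ holomorphic on A_ε^N such that A₁ z = B z * g (z 1) and A₂ z = −B z * g (z 0) for all z ∈ A_ε^N. -/
/-- The annulus `A_ε = {z : ℂ | 1 − ε < ‖z‖ < 1 + ε}` around the unit circle. -/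
def annulus (ε : ℝ) : Set ℂ := {z : ℂ | 1 - ε < ‖z‖ ∧ ‖z‖ < 1 + ε}

/-- The polyannulus `A_ε^N = {z : Fin N → ℂ | ∀ i, z i ∈ A_ε}`. -/
def polyAnnulus (ε : ℝ) (N : ℕ) : Set (Fin N → ℂ) := {z | ∀ i, z i ∈ annulus ε}

open Metric Set Filter Topology MeasureTheory

/-- Differentiation under the integral sign for a bounded holomorphic family. -/
theorem diff_param_aux {N : ℕ} (K : (Fin N → ℂ) → ℝ → ℂ) (x₀ : Fin N → ℂ) (R M a b : ℝ)
    (hR : 0 < R) (hab : a ≤ b)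
    (hd : ∀ θ, DifferentiableOn ℂ (fun z => K z θ) (ball x₀ R))
    (hM : ∀ z ∈ ball x₀ R, ∀ θ, ‖K z θ‖ ≤ M)
    (hc : ∀ z ∈ ball x₀ R, Continuous (K z)) :
    DifferentiableAt ℂ (fun z => ∫ θ in a..b, K z θ) x₀ := by
  have hx₀ : x₀ ∈ ball x₀ R := mem_ball_self hR
  have hda : ∀ θ, HasFDerivAt (fun z => K z θ) (fderiv ℂ (fun z => K z θ) x₀) x₀ := fun θ =>
    ((hd θ).differentiableAt (isOpen_ball.mem_nhds hx₀)).hasFDerivAt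
  have hmeas1 : ∀ v : Fin N → ℂ, Measurable (fun θ => fderiv ℂ (fun z => K z θ) x₀ v) := by
    intro v
    have hev : ∀ᶠ n : ℕ in atTop, x₀ + ((n : ℂ))⁻¹ • v ∈ ball x₀ R := by
      have ht : Tendsto (fun n : ℕ => x₀ + ((n : ℂ))⁻¹ • v) atTop (𝓝 (x₀ + (0 : ℂ) • v)) :=
        tendsto_const_nhds.add ((tendsto_inv_atTop_nhds_zero_nat (𝕜 := ℂ)).smul_const v)
      refine ht.eventually (isOpen_ball.mem_nhds ?_)
      simpa using hR
    obtain ⟨n₀, hn₀⟩ := eventually_atTop.1 hev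
    refine measurable_of_tendsto_metrizable (f := fun (n : ℕ) θ =>
      ((n + n₀ : ℕ) : ℂ) • (K (x₀ + ((n + n₀ : ℕ) : ℂ)⁻¹ • v) θ - K x₀ θ)) ?_ ?_
    · intro n
      have h1 := (hc _ (hn₀ (n + n₀) (by omega))).measurable
      have h2 := (hc _ hx₀).measurable
      exact (h1.sub h2).const_smul ((n + n₀ : ℕ) : ℂ)
    · rw [tendsto_pi_nhds]
      intro θ
      have h := (hda θ).lim v (c := fun n : ℕ => (n : ℂ)) (l := atTop)
        (by simpa using tendsto_natCast_atTop_atTop (R := ℝ))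
      exact (tendsto_add_atTop_iff_nat n₀).2 h
  have hmeas : Measurable (fun θ => fderiv ℂ (fun z => K z θ) x₀) := by
    have : (fun θ => fderiv ℂ (fun z => K z θ) x₀) = fun θ =>
        ∑ i, (fderiv ℂ (fun z => K z θ) x₀ (Pi.single i 1)) •
          (ContinuousLinearMap.proj i : (Fin N → ℂ) →L[ℂ] ℂ) := by
      funext θ
      ext v
      conv_lhs => rw [pi_eq_sum_univ' v]
      simp [map_sum, mul_comm]
    rw [this]
    exact Finset.measurable_sum _ fun i _ => (hmeas1 _).smul_const _
  simp only [intervalIntegral.integral_of_le hab]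
  refine (hasFDerivAt_integral_of_dominated_loc_of_lip' (s := ball x₀ R)
    (bound := fun _ => (2 * M) / R) (F' := fun θ => fderiv ℂ (fun z => K z θ) x₀)
    (isOpen_ball.mem_nhds hx₀) (fun x hx => (hc x hx).aestronglyMeasurable) ?_
    hmeas.aestronglyMeasurable (ae_of_all _ ?_) (integrable_const _)
    (ae_of_all _ hda)).2.differentiableAt
  · exact ((hc _ hx₀).integrableOn_Icc).mono_set Ioc_subset_Icc_self
  · intro θ x hx
    have h := Complex.dist_le_div_mul_dist_of_mapsTo_ball (R₂ := 2 * M) (hd θ) ?_ hx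
    · simpa only [dist_eq_norm] using h
    · intro y hy
      rw [mem_closedBall, dist_eq_norm]
      have := norm_sub_le (K y θ) (K x₀ θ)
      linarith [hM y hy θ, hM x₀ hx₀ θ]

theorem isOpen_annulus_aux (ε : ℝ) : IsOpen (annulus ε) :=
  (isOpen_lt continuous_const continuous_norm).inter (isOpen_lt continuous_norm continuous_const)

theorem isOpen_polyAnnulus_aux (ε : ℝ) (N : ℕ) : IsOpen (polyAnnulus ε N) := by
  have : polyAnnulus ε N = ⋂ i, (fun z : Fin N → ℂ => z i) ⁻¹' annulus ε := by
    ext z; simp [polyAnnulus]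
  rw [this]
  exact isOpen_iInter_of_finite fun i => (isOpen_annulus_aux ε).preimage (continuous_apply i)

theorem isPreconnected_annulus_aux (ε : ℝ) : IsPreconnected (annulus ε) := by
  have : annulus ε = (fun x : ℝ × ℝ => (x.1 : ℂ) * Complex.exp (x.2 * Complex.I)) ''
      ((Ici 0 ∩ Ioo (1 - ε) (1 + ε)) ×ˢ univ) := by
    ext z
    constructor
    · intro hz
      exact ⟨(‖z‖, z.arg), ⟨⟨norm_nonneg z, hz⟩, mem_univ _⟩, Complex.norm_mul_exp_arg_mul_I z⟩
    · rintro ⟨⟨r, t⟩, ⟨⟨h0, h1⟩, -⟩, rfl⟩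
      have h0' : (0 : ℝ) ≤ r := h0
      have : ‖(r : ℂ) * Complex.exp (t * Complex.I)‖ = r := by
        rw [norm_mul, Complex.norm_exp_ofReal_mul_I, mul_one, Complex.norm_real,
          Real.norm_of_nonneg h0']
      simp only [annulus, Set.mem_ofPred_eq, this]
      exact h1
  rw [this]
  refine IsPreconnected.image ?_ _ (by fun_prop)
  exact (((convex_Ici (0 : ℝ)).inter (convex_Ioo _ _)).isPreconnected).prod isPreconnected_univ

theorem isolated_aux {ε : ℝ} {g : ℂ → ℂ} (hg : DifferentiableOn ℂ g (annulus ε))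
    (hg0 : ∃ z ∈ annulus ε, g z ≠ 0) {a : ℂ} (ha : a ∈ annulus ε) :
    ∀ᶠ w in 𝓝[≠] a, g w ≠ 0 := by
  have han := hg.analyticOnNhd (isOpen_annulus_aux ε)
  rcases (han a ha).eventually_eq_zero_or_eventually_ne_zero with h | h
  · obtain ⟨z, hz, hne⟩ := hg0
    exact absurd (han.eqOn_zero_of_preconnected_of_eventuallyEq_zero
      (isPreconnected_annulus_aux ε) ha h hz) hne
  · exact h

theorem dens_aux {ε : ℝ} {g : ℂ → ℂ} (hg : DifferentiableOn ℂ g (annulus ε))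
    (hg0 : ∃ z ∈ annulus ε, g z ≠ 0) {N : ℕ} (i : Fin N) {z : Fin N → ℂ}
    (hz : z ∈ polyAnnulus ε N) {f h : (Fin N → ℂ) → ℂ} (hf : ContinuousAt f z)
    (hh : ContinuousAt h z) (hfh : ∀ᶠ x in 𝓝 z, g (x i) ≠ 0 → f x = h x) : f z = h z := by
  have ht : Tendsto (fun t => Function.update z i t) (𝓝[≠] (z i)) (𝓝 z) := by
    have : ContinuousAt (fun t => Function.update z i t) (z i) := by
      apply Continuous.continuousAt; fun_prop
    have h2 := this.tendsto
    rw [Function.update_eq_self] at h2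
    exact h2.mono_left nhdsWithin_le_nhds
  refine tendsto_nhds_unique_of_eventuallyEq (hf.tendsto.comp ht) (hh.tendsto.comp ht) ?_
  filter_upwards [ht.eventually hfh, isolated_aux hg hg0 (hz i)] with t h1 h2
  exact h1 (by simpa using h2)

theorem local_aux {ε : ℝ} {g : ℂ → ℂ} (hg : DifferentiableOn ℂ g (annulus ε))
    (hg0 : ∃ z ∈ annulus ε, g z ≠ 0) {N : ℕ} (i j : Fin N) (hij : i ≠ j)
    {A₁ A₂ : (Fin N → ℂ) → ℂ}
    (hA₁ : DifferentiableOn ℂ A₁ (polyAnnulus ε N))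
    (hA₂ : DifferentiableOn ℂ A₂ (polyAnnulus ε N))
    (heq : ∀ z ∈ polyAnnulus ε N, A₁ z * g (z i) + A₂ z * g (z j) = 0)
    {p : Fin N → ℂ} (hp : p ∈ polyAnnulus ε N) :
    ∃ B : (Fin N → ℂ) → ℂ, ∀ᶠ z in 𝓝 p, DifferentiableAt ℂ B z ∧
      A₁ z = B z * g (z j) ∧ A₂ z = -(B z * g (z i)) := by
  have hPo := isOpen_polyAnnulus_aux ε N
  obtain ⟨r, hr, hrP, hrg⟩ : ∃ r > 0, closedBall p r ⊆ polyAnnulus ε N ∧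
      ∀ w ∈ closedBall (p j) r, w ≠ p j → g w ≠ 0 := by
    have h1 := isolated_aux hg hg0 (hp j)
    rw [eventually_nhdsWithin_iff] at h1
    obtain ⟨r1, hr1, h1⟩ := nhds_basis_closedBall.eventually_iff.1 h1
    obtain ⟨r2, hr2, h2⟩ := nhds_basis_closedBall.mem_iff.1 (hPo.mem_nhds hp)
    refine ⟨min r1 r2, lt_min hr1 hr2,
      (closedBall_subset_closedBall (min_le_right _ _)).trans h2, fun w hw hne =>
      h1 (closedBall_subset_closedBall (min_le_left _ _) hw) hne⟩
  have hupd : ∀ z ∈ ball p r, ∀ w ∈ closedBall (p j) r,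
      Function.update z j w ∈ closedBall p r := by
    intro z hz w hw
    rw [mem_closedBall, dist_pi_le_iff hr.le]
    intro k
    by_cases hk : k = j
    · subst hk; simpa using hw
    · rw [Function.update_of_ne hk]
      exact (dist_le_pi_dist z p k).trans (mem_ball.1 hz).le
  have hsP : ∀ w ∈ closedBall (p j) r, w ∈ annulus ε := by
    intro w hw
    have := hrP (hupd p (mem_ball_self hr) w hw) j
    simpa using this
  have hsne : ∀ w ∈ sphere (p j) r, g w ≠ 0 := fun w hw =>
    hrg w (sphere_subset_closedBall hw) (ne_of_mem_sphere hw hr.ne')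
  obtain ⟨C, hC⟩ := (isCompact_closedBall p r).exists_bound_of_continuousOn
    (hA₁.continuousOn.mono hrP)
  have hginv : ContinuousOn (fun w => (g w)⁻¹) (sphere (p j) r) :=
    (hg.continuousOn.mono fun w hw => hsP w (sphere_subset_closedBall hw)).inv₀ hsne
  obtain ⟨D, hD⟩ := (isCompact_sphere (p j) r).exists_bound_of_continuousOn hginv
  have hcm : ∀ θ, circleMap (p j) r θ ∈ sphere (p j) r := circleMap_mem_sphere _ hr.le
  have hsub : ball p (r / 2) ⊆ ball p r := ball_subset_ball (by linarith)
  have hlow : ∀ z ∈ ball p (r / 2), ∀ w ∈ sphere (p j) r, r / 2 ≤ ‖w - z j‖ := by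
    intro z hz w hw
    have h1 : dist (z j) (p j) < r / 2 := (dist_le_pi_dist z p j).trans_lt (mem_ball.1 hz)
    have h2 : dist w (p j) = r := hw
    have h3 := dist_triangle w (z j) (p j)
    rw [← dist_eq_norm]; linarith
  have hlow0 : ∀ z ∈ ball p (r / 2), ∀ w ∈ sphere (p j) r, w - z j ≠ 0 := by
    intro z hz w hw h0
    have := hlow z hz w hw
    rw [h0, norm_zero] at this; linarith
  set K : (Fin N → ℂ) → ℝ → ℂ := fun z θ => deriv (circleMap (p j) r) θ •
    ((circleMap (p j) r θ - z j)⁻¹ • (A₁ (Function.update z j (circleMap (p j) r θ)) *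
      (g (circleMap (p j) r θ))⁻¹)) with hK
  have hKd : ∀ θ, DifferentiableOn ℂ (fun z => K z θ) (ball p (r / 2)) := by
    intro θ z hz
    have hA : DifferentiableAt ℂ A₁ (Function.update z j (circleMap (p j) r θ)) :=
      hA₁.differentiableAt (hPo.mem_nhds (hrP (hupd z (hsub hz) _
        (sphere_subset_closedBall (hcm θ)))))
    have hu : DifferentiableAt ℂ (fun z : Fin N → ℂ =>
        Function.update z j (circleMap (p j) r θ)) z := by
      rw [differentiableAt_pi]
      intro k
      by_cases hk : k = j
      · subst hk; simp
      · simp only [Function.update_of_ne hk]; fun_prop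
    have h1 : DifferentiableAt ℂ (fun z : Fin N → ℂ =>
        A₁ (Function.update z j (circleMap (p j) r θ))) z := hA.comp z hu
    have h2 : DifferentiableAt ℂ (fun z : Fin N → ℂ => (circleMap (p j) r θ - z j)⁻¹) z :=
      DifferentiableAt.inv (by fun_prop) (hlow0 z hz _ (hcm θ))
    exact ((h2.smul (h1.mul_const (g (circleMap (p j) r θ))⁻¹)).const_smul
      (deriv (circleMap (p j) r) θ)).differentiableWithinAt
  have hKM : ∀ z ∈ ball p (r / 2), ∀ θ, ‖K z θ‖ ≤ r * ((r / 2)⁻¹ * (C * D)) := by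
    intro z hz θ
    have h1 := hC _ (hupd z (hsub hz) _ (sphere_subset_closedBall (hcm θ)))
    have h2 := hD _ (hcm θ)
    have h3 := hlow z hz _ (hcm θ)
    have hC0 : 0 ≤ C := (norm_nonneg _).trans h1
    simp only [hK, norm_smul, norm_mul]
    have h4 : ‖deriv (circleMap (p j) r) θ‖ = r := by
      simp [deriv_circleMap, abs_of_pos hr]
    rw [h4, norm_inv (_ - _)]
    gcongr
  have hKc : ∀ z ∈ ball p (r / 2), Continuous (K z) := by
    intro z hz
    have h1 : Continuous fun θ => A₁ (Function.update z j (circleMap (p j) r θ)) := by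
      refine hA₁.continuousOn.comp_continuous ?_ fun θ =>
        hrP (hupd z (hsub hz) _ (sphere_subset_closedBall (hcm θ)))
      exact continuous_const.update j (continuous_circleMap _ _)
    have h2 : Continuous fun θ => (g (circleMap (p j) r θ))⁻¹ :=
      hginv.comp_continuous (continuous_circleMap _ _) hcm
    have h3 : Continuous fun θ => (circleMap (p j) r θ - z j)⁻¹ :=
      ((continuous_circleMap _ _).sub continuous_const).inv₀ fun θ => hlow0 z hz _ (hcm θ)
    have h4 : Continuous fun θ => deriv (circleMap (p j) r) θ := by
      simp only [deriv_circleMap]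
      exact (continuous_circleMap _ _).mul continuous_const
    exact h4.smul (h3.smul (h1.mul h2))
  set B : (Fin N → ℂ) → ℂ := fun z =>
    (2 * Real.pi * Complex.I : ℂ)⁻¹ • ∫ θ in (0 : ℝ)..2 * Real.pi, K z θ with hB
  have hBd : ∀ z ∈ ball p (r / 2), DifferentiableAt ℂ B z := by
    intro z hz
    obtain ⟨δ, hδ, hδs⟩ := Metric.isOpen_iff.1 isOpen_ball z hz
    exact (diff_param_aux K z δ _ 0 (2 * Real.pi) hδ Real.two_pi_pos.le
      (fun θ => (hKd θ).mono hδs) (fun y hy => hKM y (hδs hy))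
      (fun y hy => hKc y (hδs hy))).const_smul (2 * Real.pi * Complex.I : ℂ)⁻¹
  have hBP : ball p (r / 2) ⊆ polyAnnulus ε N :=
    (hsub.trans ball_subset_closedBall).trans hrP
  have hB1 : ∀ z ∈ ball p (r / 2), g (z i) ≠ 0 → A₂ z = -(B z * g (z i)) := by
    intro z hz hgz
    have hzj : z j ∈ ball (p j) r :=
      mem_ball.2 ((dist_le_pi_dist z p j).trans_lt (mem_ball.1 (hsub hz)))
    have hdiff : DifferentiableOn ℂ (fun w => -A₂ (Function.update z j w) * (g (z i))⁻¹)
        (closedBall (p j) r) := by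
      intro w hw
      have hA : DifferentiableAt ℂ A₂ (Function.update z j w) :=
        hA₂.differentiableAt (hPo.mem_nhds (hrP (hupd z (hsub hz) w hw)))
      have hu : DifferentiableAt ℂ (fun w : ℂ => Function.update z j w) w :=
        (hasFDerivAt_update z w).differentiableAt
      exact ((hA.comp w hu).neg.mul_const _).differentiableWithinAt
    have hcau := DiffContOnCl.two_pi_i_inv_smul_circleIntegral_sub_inv_smul
      (DifferentiableOn.diffContOnCl (by rwa [closure_ball _ hr.ne'])) hzj
    have hBz : B z = -A₂ z * (g (z i))⁻¹ := by
      rw [Function.update_eq_self] at hcau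
      rw [← hcau]
      simp only [hB, hK, circleIntegral]
      congr 1
      refine intervalIntegral.integral_congr fun θ _ => ?_
      congr 2
      have h1 := heq _ (hrP (hupd z (hsub hz) _ (sphere_subset_closedBall (hcm θ))))
      rw [Function.update_of_ne hij, Function.update_self] at h1
      have h2 := hsne _ (hcm θ)
      field_simp
      linear_combination h1
    rw [hBz]; field_simp
  have hgc : ∀ z ∈ polyAnnulus ε N, ∀ k, ContinuousAt (fun x : Fin N → ℂ => g (x k)) z := by
    intro z hz k
    exact ContinuousAt.comp (f := fun x : Fin N → ℂ => x k) (g := g)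
      (hg.continuousOn.continuousAt ((isOpen_annulus_aux ε).mem_nhds (hz k)))
      (continuous_apply k).continuousAt
  refine ⟨B, ?_⟩
  filter_upwards [isOpen_ball.mem_nhds (mem_ball_self (x := p) (half_pos hr))] with z hz
  have hzP := hBP hz
  have hnear := isOpen_ball.mem_nhds hz
  have hBc := (hBd z hz).continuousAt
  refine ⟨hBd z hz, ?_, ?_⟩
  · refine dens_aux hg hg0 i hzP (f := A₁) (h := fun z => B z * g (z j))
      (hA₁.continuousOn.continuousAt (hPo.mem_nhds hzP)) (hBc.mul (hgc z hzP j)) ?_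
    filter_upwards [hnear] with x hx hgx
    have h1 := hB1 x hx hgx
    have h2 := heq x (hBP hx)
    apply mul_right_cancel₀ hgx
    linear_combination h2 - g (x j) * h1
  · refine dens_aux hg hg0 i hzP (f := A₂) (h := fun z => -(B z * g (z i)))
      (hA₂.continuousOn.continuousAt (hPo.mem_nhds hzP)) (hBc.mul (hgc z hzP i)).neg ?_
    filter_upwards [hnear] with x hx hgx using hB1 x hx hgx

/-- Appendix B solution of the linear `∇̃`-equation, case `M = 2`: if `A₁, A₂` are
holomorphic on the polyannulus and `A₁ z * g (z 0) + A₂ z * g (z 1) = 0` there,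
with `g` holomorphic and not identically zero on the annulus, then
`A₁ z = B z * g (z 1)` and `A₂ z = −B z * g (z 0)` for some holomorphic `B`. -/
theorem linear_nabla_equation_M2 (ε : ℝ) (hε : 0 < ε) (g : ℂ → ℂ)
    (hg : DifferentiableOn ℂ g (annulus ε))
    (hg0 : ∃ z ∈ annulus ε, g z ≠ 0)
    (N : ℕ) (hN : 2 ≤ N)
    (A₁ A₂ : (Fin N → ℂ) → ℂ)
    (hA₁ : DifferentiableOn ℂ A₁ (polyAnnulus ε N))
    (hA₂ : DifferentiableOn ℂ A₂ (polyAnnulus ε N))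
    (heq : ∀ z ∈ polyAnnulus ε N,
      A₁ z * g (z ⟨0, by omega⟩) + A₂ z * g (z ⟨1, by omega⟩) = 0) :
    ∃ B : (Fin N → ℂ) → ℂ,
      DifferentiableOn ℂ B (polyAnnulus ε N) ∧
      ∀ z ∈ polyAnnulus ε N,
        A₁ z = B z * g (z ⟨1, by omega⟩) ∧ A₂ z = -(B z * g (z ⟨0, by omega⟩)) := by
  have hPo := isOpen_polyAnnulus_aux ε N
  have hij : (⟨0, by omega⟩ : Fin N) ≠ ⟨1, by omega⟩ := by simp
  choose! b hb using fun (p : Fin N → ℂ) (hp : p ∈ polyAnnulus ε N) =>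
    local_aux hg hg0 _ _ hij hA₁ hA₂ heq hp
  refine ⟨fun p => b p p, ?_, fun z hz => (hb z hz).self_of_nhds.2⟩
  intro p hp
  refine DifferentiableAt.differentiableWithinAt ?_
  refine (hb p hp).self_of_nhds.1.congr_of_eventuallyEq ?_
  filter_upwards [(hb p hp).eventually_nhds, hPo.mem_nhds hp] with q hq hqP
  refine dens_aux hg hg0 ⟨0, by omega⟩ hqP (f := b q) (h := b p)
    (hb q hqP).self_of_nhds.1.continuousAt hq.self_of_nhds.1.continuousAt ?_
  filter_upwards [hb q hqP, hq] with x h1 h2 hgx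
  apply mul_right_cancel₀ hgx
  linear_combination h1.2.2 - h2.2.2
end
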